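/- Let G be a finite simple bipartite graph with bipartition (X,Y), |X| = m, |Y| = n, m ≤ n, and suppose there exist two weighted bi-adjacency matrices B and C of G over a field F (rows indexed by X, columns by Y) with B·Cᵀ = I_m. If H is the induced subgraph obtained from G by deleting k vertices of X (0 ≤ k ≤ m), then f(H □ K_2) = m − k. -/

import Mathlib

open SimpleGraph

noncomputable def forcingNumber {V : Type*} (G : SimpleGraph V) (M : G.Subgraph) : ℕ :=
  sInf {c | ∃ S : Set (Sym2 V), S ⊆ M.edgeSet ∧ S.ncard = c ∧
    ∀ M' : G.Subgraph, M'.IsPerfectMatching → S ⊆ M'.edgeSet → M' = M}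

noncomputable def minForcingNumber {V : Type*} (G : SimpleGraph V) : ℕ :=
  sInf {c | ∃ M : G.Subgraph, M.IsPerfectMatching ∧ forcingNumber G M = c}


/-- The subgraph of a bipartite graph given by matching each left vertex with its image under a
bijection onto the right vertices. -/
def matchingOfEquiv {V R K : Type*} (Γ : SimpleGraph V) (e : R ⊕ K ≃ V) (ρ : R ≃ K)
    (h : ∀ r, Γ.Adj (e (Sum.inl r)) (e (Sum.inr (ρ r)))) : Γ.Subgraph where
  verts := Set.univ
  Adj u v := ∃ r, (u = e (Sum.inl r) ∧ v = e (Sum.inr (ρ r))) ∨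
    (v = e (Sum.inl r) ∧ u = e (Sum.inr (ρ r)))
  adj_sub := by
    rintro u v ⟨r, ⟨rfl, rfl⟩ | ⟨rfl, rfl⟩⟩
    exacts [h r, (h r).symm]
  edge_vert _ := Set.mem_univ _
  symm := ⟨fun _ _ ⟨r, hr⟩ => ⟨r, hr.symm⟩⟩

theorem matchingOfEquiv_isPerfectMatching {V R K : Type*} (Γ : SimpleGraph V) (e : R ⊕ K ≃ V)
    (ρ : R ≃ K) (h : ∀ r, Γ.Adj (e (Sum.inl r)) (e (Sum.inr (ρ r)))) :
    (matchingOfEquiv Γ e ρ h).IsPerfectMatching := by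
  rw [Subgraph.isPerfectMatching_iff]
  intro v
  obtain ⟨r | c, rfl⟩ := e.surjective v
  · refine ⟨e (Sum.inr (ρ r)), ⟨r, Or.inl ⟨rfl, rfl⟩⟩, ?_⟩
    rintro w ⟨r', ⟨h1, rfl⟩ | ⟨rfl, h1⟩⟩
    · obtain rfl : r = r' := by simpa using h1
      rfl
    · simp at h1
  · refine ⟨e (Sum.inl (ρ.symm c)), ⟨ρ.symm c, Or.inr ⟨rfl, by simp⟩⟩, ?_⟩
    rintro w ⟨r', ⟨h1, rfl⟩ | ⟨rfl, h1⟩⟩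
    · simp at h1
    · obtain rfl : c = ρ r' := by simpa using h1
      simp

/-- A perfect matching of a bipartite graph is a bijection between the two parts. -/
theorem exists_equiv_of_isPerfectMatching {V R K : Type*} {Γ : SimpleGraph V} (e : R ⊕ K ≃ V)
    (hR : ∀ r r', ¬ Γ.Adj (e (Sum.inl r)) (e (Sum.inl r')))
    (hK : ∀ c c', ¬ Γ.Adj (e (Sum.inr c)) (e (Sum.inr c')))
    {M : Γ.Subgraph} (hM : M.IsPerfectMatching) :
    ∃ σ : R ≃ K, ∀ r c, M.Adj (e (Sum.inl r)) (e (Sum.inr c)) ↔ c = σ r := by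
  rw [Subgraph.isPerfectMatching_iff] at hM
  have h1 : ∀ r, ∃ c, M.Adj (e (Sum.inl r)) (e (Sum.inr c)) := by
    intro r
    obtain ⟨w, hw, -⟩ := hM (e (Sum.inl r))
    obtain ⟨r' | c, rfl⟩ := e.surjective w
    · exact absurd hw.adj_sub (hR _ _)
    · exact ⟨c, hw⟩
  have h2 : ∀ c, ∃ r, M.Adj (e (Sum.inr c)) (e (Sum.inl r)) := by
    intro c
    obtain ⟨w, hw, -⟩ := hM (e (Sum.inr c))
    obtain ⟨r | c', rfl⟩ := e.surjective w
    · exact ⟨r, hw⟩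
    · exact absurd hw.adj_sub (hK _ _)
  choose s hs using h1
  choose t ht using h2
  refine ⟨⟨s, t, fun r => ?_, fun c => ?_⟩, fun r c => ⟨fun h => ?_, ?_⟩⟩
  · simpa using (hM _).unique (ht (s r)) (hs r).symm
  · simpa using (hM _).unique (hs (t c)) (ht c).symm
  · simpa using (hM _).unique h (hs r)
  · rintro rfl
    exact hs r

/-- The size of a forcing set of a bipartite graph is at least the corank of any weighted
bi-adjacency matrix, here with the rank bounded through a factorization. -/
theorem card_le_ncard_forcingSet_add {V R K Y F : Type*} [Fintype R] [Fintype Y]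
    [DecidableEq R] [Field F] {Γ : SimpleGraph V} (e : R ⊕ K ≃ V)
    (hR : ∀ r r', ¬ Γ.Adj (e (Sum.inl r)) (e (Sum.inl r')))
    (hK : ∀ c c', ¬ Γ.Adj (e (Sum.inr c)) (e (Sum.inr c')))
    (P : Matrix R Y F) (Q : Matrix Y K F)
    (hA : ∀ r c, (P * Q) r c ≠ 0 ↔ Γ.Adj (e (Sum.inl r)) (e (Sum.inr c)))
    {M : Γ.Subgraph} (hM : M.IsPerfectMatching) {S : Set (Sym2 V)} (hSM : S ⊆ M.edgeSet)
    (hSfin : S.Finite)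
    (hS : ∀ M' : Γ.Subgraph, M'.IsPerfectMatching → S ⊆ M'.edgeSet → M' = M) :
    Fintype.card R ≤ S.ncard + Fintype.card Y := by
  classical
  obtain ⟨σ, hσ⟩ := exists_equiv_of_isPerfectMatching e hR hK hM
  let g : R → Sym2 V := fun r => s(e (Sum.inl r), e (Sum.inr (σ r)))
  have hg : Function.Injective g := by
    intro r r' h
    simpa [g] using h
  let A : Matrix {r // g r ∉ S} {r // g r ∉ S} F := (P * Q).submatrix (·.1) (fun r => σ r.1)
  have hdet : A.det ≠ 0 := by
    rw [← Matrix.det_transpose, Matrix.det_apply, Finset.sum_eq_single 1]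
    · simp only [Equiv.Perm.sign_one, one_smul, Equiv.Perm.one_apply]
      refine Finset.prod_ne_zero_iff.2 fun r _ => ?_
      exact (hA _ _).2 ((hσ _ _).2 rfl).adj_sub
    · intro τ _ hτ
      by_contra hne
      apply hτ
      have hprod : ∀ i : {r // g r ∉ S}, (P * Q) i.1 (σ (τ i).1) ≠ 0 := by
        intro i hi
        apply hne
        rw [Finset.prod_eq_zero (Finset.mem_univ i) (by simpa [A] using hi), smul_zero]
      let ρ : R ≃ K := (Equiv.Perm.ofSubtype τ).trans σ
      have hρmem : ∀ r (hr : g r ∉ S), ρ r = σ (τ ⟨r, hr⟩).1 := fun r hr => by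
        simp only [ρ, Equiv.trans_apply]
        rw [Equiv.Perm.ofSubtype_apply_of_mem τ hr]
      have hρnot : ∀ r, g r ∈ S → ρ r = σ r := fun r hr => by
        simp only [ρ, Equiv.trans_apply]
        rw [Equiv.Perm.ofSubtype_apply_of_not_mem τ (not_not.2 hr)]
      have hadj : ∀ r, Γ.Adj (e (Sum.inl r)) (e (Sum.inr (ρ r))) := by
        intro r
        by_cases hr : g r ∈ S
        · rw [hρnot r hr]
          exact ((hσ _ _).2 rfl).adj_sub
        · rw [hρmem r hr]
          exact (hA _ _).1 (hprod ⟨r, hr⟩)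
      have heq := hS _ (matchingOfEquiv_isPerfectMatching Γ e ρ hadj) (by
        intro z hz
        obtain ⟨r, rfl⟩ : ∃ r, z = g r := by
          have hzM := hSM hz
          induction z with
          | h u v =>
            rw [Subgraph.mem_edgeSet] at hzM
            obtain ⟨r | c, rfl⟩ := e.surjective u <;> obtain ⟨r' | c', rfl⟩ := e.surjective v
            · exact absurd hzM.adj_sub (hR _ _)
            · exact ⟨r, by rw [(hσ _ _).1 hzM]⟩
            · exact ⟨r', by rw [(hσ _ _).1 hzM.symm]; exact Sym2.eq_swap⟩
            · exact absurd hzM.adj_sub (hK _ _)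
        exact ⟨r, Or.inl ⟨rfl, by rw [hρnot r hz]⟩⟩)
      ext i
      have h1 : M.Adj (e (Sum.inl i.1)) (e (Sum.inr (ρ i.1))) := by
        rw [← heq]
        exact ⟨i.1, Or.inl ⟨rfl, rfl⟩⟩
      have h2 := (hσ _ _).1 h1
      rw [hρmem i.1 i.2] at h2
      simpa using h2
    · simp
  have hrank : Fintype.card {r // g r ∉ S} ≤ Fintype.card Y := by
    have hfac : A = P.submatrix (fun r : {r // g r ∉ S} => r.1) id *
        Q.submatrix id (fun r : {r // g r ∉ S} => σ r.1) := rfl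
    rw [← Matrix.rank_of_isUnit A ((Matrix.isUnit_iff_isUnit_det A).2 hdet.isUnit), hfac]
    exact (Matrix.rank_mul_le_left _ _).trans (Matrix.rank_le_card_width _)
  have hcard : Fintype.card {r // g r ∈ S} ≤ S.ncard := by
    rw [← Nat.card_eq_fintype_card]
    change {r | g r ∈ S}.ncard ≤ S.ncard
    exact Set.ncard_le_ncard_of_injOn g (fun _ h => h) hg.injOn hSfin
  have := Fintype.card_subtype_compl (fun r => g r ∈ S)
  have := Fintype.card_subtype_le (fun r => g r ∈ S)
  omega

/-- The perfect matching of the prism `H □ K₂` joining the two copies of each vertex. -/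
def prismMatching {W : Type*} (H : SimpleGraph W) :
    (H □ (⊤ : SimpleGraph (Fin 2))).Subgraph where
  verts := Set.univ
  Adj u v := u.1 = v.1 ∧ u.2 ≠ v.2
  adj_sub {u v} h := by simp [SimpleGraph.boxProd_adj, h.1, h.2]
  edge_vert _ := Set.mem_univ _
  symm := ⟨fun _ _ h => ⟨h.1.symm, h.2.symm⟩⟩

theorem prismMatching_isPerfectMatching {W : Type*} (H : SimpleGraph W) :
    (prismMatching H).IsPerfectMatching := by
  rw [Subgraph.isPerfectMatching_iff]
  rintro ⟨w, i⟩
  refine ⟨(w, 1 - i), ⟨rfl, (by decide : ∀ i : Fin 2, i ≠ 1 - i) i⟩, ?_⟩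
  · rintro ⟨w', j⟩ ⟨h1, h2⟩
    simp only at h1 h2
    exact Prod.ext h1.symm ((by decide : ∀ i j : Fin 2, i ≠ j → j = 1 - i) i j h2)

/-- The edges of the prism above a vertex cover form a forcing set of the canonical matching. -/
theorem eq_prismMatching {W : Type*} {H : SimpleGraph W} {T : Set W}
    (hT : ∀ u v, H.Adj u v → u ∈ T ∨ v ∈ T)
    {M : (H □ (⊤ : SimpleGraph (Fin 2))).Subgraph} (hM : M.IsPerfectMatching)
    (hS : (fun w : W => s((w, (0 : Fin 2)), (w, (1 : Fin 2)))) '' T ⊆ M.edgeSet) :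
    M = prismMatching H := by
  have hM' := Subgraph.isPerfectMatching_iff.1 hM
  have hTadj : ∀ w ∈ T, ∀ i j : Fin 2, i ≠ j → M.Adj (w, i) (w, j) := by
    intro w hw i j hij
    have h : M.Adj (w, 0) (w, 1) := hS ⟨w, hw, rfl⟩
    fin_cases i <;> fin_cases j <;> simp at hij
    exacts [h, h.symm]
  have hsub : ∀ u v, M.Adj u v → u.1 = v.1 ∧ u.2 ≠ v.2 := by
    rintro ⟨w, i⟩ ⟨w', j⟩ h
    rcases SimpleGraph.boxProd_adj.1 h.adj_sub with ⟨h1, h2⟩ | ⟨h1, h2⟩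
    · exfalso
      have hne : i ≠ 1 - i := (by decide : ∀ i : Fin 2, i ≠ 1 - i) i
      simp only at h1 h2
      subst h2
      rcases hT _ _ h1 with hw | hw
      · exact hne (congrArg Prod.snd ((hM' _).unique h (hTadj w hw i (1 - i) hne)))
      · exact hne (congrArg Prod.snd ((hM' _).unique h.symm (hTadj w' hw i (1 - i) hne)))
    · exact ⟨h2, h1⟩
  have hP := Subgraph.isPerfectMatching_iff.1 (prismMatching_isPerfectMatching H)
  ext u v
  · exact ⟨fun _ => Set.mem_univ _, fun _ => hM.2 u⟩
  · refine ⟨hsub u v, fun h => ?_⟩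
    obtain ⟨w, hw, -⟩ := hM' u
    rwa [(hP u).unique h (hsub u w hw)]

theorem minForcingNumber_prism_le {W : Type*} {H : SimpleGraph W} {T : Set W}
    (hT : ∀ u v, H.Adj u v → u ∈ T ∨ v ∈ T) :
    minForcingNumber (H □ (⊤ : SimpleGraph (Fin 2))) ≤ T.ncard := by
  have h : minForcingNumber (H □ (⊤ : SimpleGraph (Fin 2))) ≤ forcingNumber _ (prismMatching H) :=
    Nat.sInf_le ⟨prismMatching H, prismMatching_isPerfectMatching H, rfl⟩
  refine h.trans (Nat.sInf_le ⟨(fun w : W => s((w, (0 : Fin 2)), (w, (1 : Fin 2)))) '' T, ?_, ?_, ?_⟩)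
  · rintro _ ⟨w, -, rfl⟩
    exact ⟨rfl, by simp⟩
  · exact Set.ncard_image_of_injective _ fun w w' h => by simpa using h
  · exact fun M hM hS => eq_prismMatching hT hM hS

theorem le_minForcingNumber {V : Type*} {Γ : SimpleGraph V} {c : ℕ}
    (hne : ∃ M : Γ.Subgraph, M.IsPerfectMatching)
    (h : ∀ M : Γ.Subgraph, M.IsPerfectMatching → ∀ S ⊆ M.edgeSet,
      (∀ M' : Γ.Subgraph, M'.IsPerfectMatching → S ⊆ M'.edgeSet → M' = M) → c ≤ S.ncard) :
    c ≤ minForcingNumber Γ := by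
  obtain ⟨M₀, hM₀⟩ := hne
  refine le_csInf ⟨_, M₀, hM₀, rfl⟩ ?_
  rintro _ ⟨M, hM, rfl⟩
  refine le_csInf ⟨_, M.edgeSet, subset_rfl, rfl, fun M' hM' hsub => ?_⟩ ?_
  · have hM1 := Subgraph.isPerfectMatching_iff.1 hM
    have hM1' := Subgraph.isPerfectMatching_iff.1 hM'
    ext u v
    · exact ⟨fun _ => hM.2 u, fun _ => hM'.2 u⟩
    · have hle : ∀ w, M.Adj u w → M'.Adj u w := fun w hw => hsub (show s(u, w) ∈ M.edgeSet from hw)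
      refine ⟨fun huv => ?_, hle v⟩
      obtain ⟨w, hw, -⟩ := hM1 u
      rwa [(hM1' u).unique huv (hle w hw)]
  · rintro _ ⟨S, hSM, rfl, hS⟩
    exact h M hM S hSM hS

/-- The two colour classes of the prism over a bipartite graph with some left vertices deleted. -/
noncomputable def prismParts {X : Type*} (Y : Type*) (D : Set X) :
    ({x // x ∉ D} ⊕ Y) ⊕ (Y ⊕ {x // x ∉ D}) ≃
      {v : X ⊕ Y | ∀ x ∈ D, v ≠ Sum.inl x} × Fin 2 :=
  Equiv.ofBijective
    (Sum.elim
      (Sum.elim (fun x => (⟨Sum.inl x.1, fun z hz h => x.2 (Sum.inl_injective h ▸ hz)⟩, 0))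
        (fun y => (⟨Sum.inr y, fun _ _ h => nomatch h⟩, 1)))
      (Sum.elim (fun y => (⟨Sum.inr y, fun _ _ h => nomatch h⟩, 0))
        (fun x => (⟨Sum.inl x.1, fun z hz h => x.2 (Sum.inl_injective h ▸ hz)⟩, 1))))
    (by
      constructor
      · rintro ((⟨x, hx⟩ | y) | (y | ⟨x, hx⟩)) ((⟨x', hx'⟩ | y') | (y' | ⟨x', hx'⟩)) <;> simp
      · rintro ⟨⟨x | y, h⟩, i⟩ <;> fin_cases i
        · exact ⟨Sum.inl (Sum.inl ⟨x, fun hx => h x hx rfl⟩), rfl⟩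
        · exact ⟨Sum.inr (Sum.inr ⟨x, fun hx => h x hx rfl⟩), rfl⟩
        · exact ⟨Sum.inr (Sum.inl y), rfl⟩
        · exact ⟨Sum.inl (Sum.inr y), rfl⟩)

theorem prismParts_inl_inl {X : Type*} (Y : Type*) (D : Set X) (x : {x // x ∉ D}) :
    prismParts Y D (Sum.inl (Sum.inl x)) =
      (⟨Sum.inl x.1, fun _ hz h => x.2 (Sum.inl_injective h ▸ hz)⟩, 0) := rfl

theorem prismParts_inl_inr {X : Type*} (Y : Type*) (D : Set X) (y : Y) :
    prismParts Y D (Sum.inl (Sum.inr y)) = (⟨Sum.inr y, fun _ _ h => nomatch h⟩, 1) := rfl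

theorem prismParts_inr_inl {X : Type*} (Y : Type*) (D : Set X) (y : Y) :
    prismParts Y D (Sum.inr (Sum.inl y)) = (⟨Sum.inr y, fun _ _ h => nomatch h⟩, 0) := rfl

theorem prismParts_inr_inr {X : Type*} (Y : Type*) (D : Set X) (x : {x // x ∉ D}) :
    prismParts Y D (Sum.inr (Sum.inr x)) =
      (⟨Sum.inl x.1, fun _ hz h => x.2 (Sum.inl_injective h ▸ hz)⟩, 1) := rfl

open Matrix in
theorem stmt17 {X Y F : Type*} [Fintype X] [Fintype Y] [DecidableEq X] [DecidableEq Y] [Field F]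
    (G : SimpleGraph (X ⊕ Y))
    (hbip : ∀ u v, G.Adj u v → u.isLeft ≠ v.isLeft)
    (hmn : Fintype.card X ≤ Fintype.card Y)
    (B C : Matrix X Y F)
    (hB : ∀ x y, B x y ≠ 0 ↔ G.Adj (Sum.inl x) (Sum.inr y))
    (hC : ∀ x y, C x y ≠ 0 ↔ G.Adj (Sum.inl x) (Sum.inr y))
    (hBC : B * Cᵀ = 1)
    (k : ℕ) (D : Set X) (hD : D.ncard = k) :
    minForcingNumber
        ((G.induce {v : X ⊕ Y | ∀ x ∈ D, v ≠ Sum.inl x}) □ (⊤ : SimpleGraph (Fin 2)))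
      = Fintype.card X - k := by
  classical
  have hLL : ∀ x x', ¬ G.Adj (Sum.inl x) (Sum.inl x') := fun x x' h => hbip _ _ h rfl
  have hRR : ∀ y y', ¬ G.Adj (Sum.inr y) (Sum.inr y') := fun y y' h => hbip _ _ h rfl
  have hcard : Fintype.card {x // x ∉ D} = Fintype.card X - k := by
    rw [Fintype.card_subtype_compl, ← hD, ← Nat.card_eq_fintype_card (α := {x // x ∈ D}),
      Nat.card_coe_set_eq D]
  rw [← hcard]
  apply le_antisymm
  · let j : {x // x ∉ D} → {v : X ⊕ Y | ∀ x ∈ D, v ≠ Sum.inl x} :=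
      fun x => ⟨Sum.inl x.1, fun z hz h => x.2 (Sum.inl_injective h ▸ hz)⟩
    have hj : Function.Injective j := fun x x' h => by
      simpa [j, Subtype.ext_iff] using h
    refine (minForcingNumber_prism_le (T := Set.range j) ?_).trans_eq ?_
    · rintro ⟨x | y, hu⟩ ⟨x' | y', hv⟩ h
      · exact Or.inl ⟨⟨x, fun hx => hu x hx rfl⟩, rfl⟩
      · exact Or.inl ⟨⟨x, fun hx => hu x hx rfl⟩, rfl⟩
      · exact Or.inr ⟨⟨x', fun hx => hv x' hx rfl⟩, rfl⟩
      · exact absurd h (hRR y y')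
    · rw [← Set.image_univ, Set.ncard_image_of_injective _ hj, Set.ncard_univ,
        Nat.card_eq_fintype_card]
  · refine le_minForcingNumber ⟨_, prismMatching_isPerfectMatching _⟩ fun M hM S hSM hS => ?_
    let B' : Matrix {x // x ∉ D} Y F := B.submatrix (·.1) id
    let C' : Matrix {x // x ∉ D} Y F := C.submatrix (·.1) id
    have hBC' : B' * C'ᵀ = 1 := by
      have h : B' * C'ᵀ = (B * Cᵀ).submatrix (·.1) (·.1) := rfl
      rw [h, hBC]
      exact Matrix.submatrix_one _ Subtype.val_injective
    have key := card_le_ncard_forcingSet_add (prismParts Y D) ?_ ?_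
      (Matrix.fromRows B' 1) (Matrix.fromCols 1 C'ᵀ) ?_ hM hSM (Set.toFinite S) hS
    · rw [Fintype.card_sum] at key
      omega
    · rintro (x | y) (x' | y') <;>
        simp only [prismParts_inl_inl, prismParts_inl_inr, SimpleGraph.boxProd_adj] <;>
        simp [hLL, hRR]
    · rintro (y | x) (y' | x') <;>
        simp only [prismParts_inr_inl, prismParts_inr_inr, SimpleGraph.boxProd_adj] <;>
        simp [hLL, hRR]
    · rw [Matrix.fromRows_mul_fromCols, hBC']
      rintro (x | y) (y' | x') <;>
        simp only [prismParts_inl_inl, prismParts_inl_inr, prismParts_inr_inl, prismParts_inr_inr,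
          SimpleGraph.boxProd_adj]
      · simpa [B'] using hB x.1 y'
      · simp [Matrix.one_apply, Subtype.ext_iff]
      · simp [Matrix.one_apply]
      · simpa [C', G.adj_comm] using hC x'.1 y
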